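/- For all d, p, r ∈ ℕ there exists an increasing function h : ℕ → ℕ such that for every m ∈ ℕ with m ≥ 1 and every p-labeled graph G ∈ TM(r,p,d), there exists a p-labeled graph H ∈ TM(r,p,d) such that: (i) H is an induced labeled subgraph of G, (ii) the cardinality of H is at most tower(d, h(d)·m·(m + ⌈log₂ r⌉ + ⌈log₂ p⌉)), and (iii) H ≡^MSO_m G. -/

import Mathlib

open Cardinal

/-- The tower function: `tower 0 n = n`, `tower (d+1) n = 2 ^ tower d n`. -/
def tower : ℕ → ℕ → ℕ
  | 0, n => n
  | d + 1, n => 2 ^ tower d n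

/-- MSO formulas over the vocabulary consisting of one binary relation symbol `E`
and unary relation symbols indexed by `ι`.  First-order variables and set
variables are both indexed by `ℕ`. -/
inductive MSOForm (ι : Type u) : Type u
  | fal : MSOForm ι
  | eq : ℕ → ℕ → MSOForm ι
  | edge : ℕ → ℕ → MSOForm ι
  | pred : ι → ℕ → MSOForm ι
  | mem : ℕ → ℕ → MSOForm ι
  | imp : MSOForm ι → MSOForm ι → MSOForm ι
  | exFO : ℕ → MSOForm ι → MSOForm ι
  | exSO : ℕ → MSOForm ι → MSOForm ι

namespace MSOForm

variable {ι : Type u}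

/-- Quantifier rank: the maximum nesting depth of (first- and second-order) quantifiers. -/
def qr : MSOForm ι → ℕ
  | fal => 0
  | eq _ _ => 0
  | edge _ _ => 0
  | pred _ _ => 0
  | mem _ _ => 0
  | imp φ ψ => max φ.qr ψ.qr
  | exFO _ φ => φ.qr + 1
  | exSO _ φ => φ.qr + 1

/-- Free first-order variables. -/
def freeFO : MSOForm ι → Finset ℕ
  | fal => ∅
  | eq i j => {i, j}
  | edge i j => {i, j}
  | pred _ i => {i}
  | mem i _ => {i}
  | imp φ ψ => φ.freeFO ∪ ψ.freeFO
  | exFO n φ => φ.freeFO.erase n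
  | exSO _ φ => φ.freeFO

/-- Free set variables. -/
def freeSO : MSOForm ι → Finset ℕ
  | fal => ∅
  | eq _ _ => ∅
  | edge _ _ => ∅
  | pred _ _ => ∅
  | mem _ X => {X}
  | imp φ ψ => φ.freeSO ∪ ψ.freeSO
  | exFO _ φ => φ.freeSO
  | exSO X φ => φ.freeSO.erase X

/-- A sentence is a formula with no free variables of either kind. -/
def IsSentence (φ : MSOForm ι) : Prop := φ.freeFO = ∅ ∧ φ.freeSO = ∅

/-- First-order formulas: no set quantification and no set membership. -/
def IsFO : MSOForm ι → Prop
  | fal => True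
  | eq _ _ => True
  | edge _ _ => True
  | pred _ _ => True
  | mem _ _ => False
  | imp φ ψ => φ.IsFO ∧ ψ.IsFO
  | exFO _ φ => φ.IsFO
  | exSO _ _ => False

/-- Formulas that do not mention the binary relation symbol `E`
(i.e. formulas over a purely monadic vocabulary). -/
def NoEdge : MSOForm ι → Prop
  | fal => True
  | eq _ _ => True
  | edge _ _ => False
  | pred _ _ => True
  | mem _ _ => True
  | imp φ ψ => φ.NoEdge ∧ ψ.NoEdge
  | exFO _ φ => φ.NoEdge
  | exSO _ φ => φ.NoEdge

end MSOForm

/-- A structure over the vocabulary with one binary relation `E` and `ι`-indexed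
unary predicates: a universe, a binary relation and unary relations. -/
structure MStr (ι : Type u) where
  V : Type
  E : V → V → Prop
  P : ι → V → Prop

namespace MStr

/-- Satisfaction of an MSO formula under first-order and set variable assignments. -/
def Realize {ι : Type u} (M : MStr ι) : MSOForm ι → (ℕ → M.V) → (ℕ → Set M.V) → Prop
  | .fal, _, _ => False
  | .eq i j, v, _ => v i = v j
  | .edge i j, v, _ => M.E (v i) (v j)
  | .pred a i, v, _ => M.P a (v i)
  | .mem i X, v, s => v i ∈ s X
  | .imp φ ψ, v, s => Realize M φ v s → Realize M ψ v s
  | .exFO n φ, v, s => ∃ x : M.V, Realize M φ (Function.update v n x) s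
  | .exSO X φ, v, s => ∃ A : Set M.V, Realize M φ v (Function.update s X A)

/-- A structure satisfies a sentence. -/
def Sat {ι : Type u} (M : MStr ι) (φ : MSOForm ι) : Prop :=
  ∀ (v : ℕ → M.V) (s : ℕ → Set M.V), M.Realize φ v s

/-- `M ≡^MSO_m N` : `M` and `N` agree on all MSO sentences of quantifier rank at most `m`. -/
def MSOEquiv {ι : Type u} (m : ℕ) (M N : MStr ι) : Prop :=
  ∀ φ : MSOForm ι, φ.IsSentence → φ.qr ≤ m → (M.Sat φ ↔ N.Sat φ)

/-- `M` and `N` agree on all MSO sentences. -/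
def MSOEq {ι : Type u} (M N : MStr ι) : Prop :=
  ∀ φ : MSOForm ι, φ.IsSentence → (M.Sat φ ↔ N.Sat φ)

/-- `M ≡^FO_q N` over a purely monadic vocabulary: `M` and `N` agree on all
first-order sentences (not mentioning `E`) of quantifier rank at most `q`. -/
def FOEquiv {ι : Type u} (q : ℕ) (M N : MStr ι) : Prop :=
  ∀ φ : MSOForm ι, φ.IsFO → φ.NoEdge → φ.IsSentence → φ.qr ≤ q → (M.Sat φ ↔ N.Sat φ)

end MStr

/-- A (finite or infinite) `p`-labeled graph: a simple undirected loop-free graph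
each of whose vertices carries exactly one label from `Fin p`. -/
structure PGraph (p : ℕ) where
  V : Type
  adj : V → V → Prop
  symm : ∀ u v, adj u v → adj v u
  irrefl : ∀ v, ¬ adj v v
  label : V → Fin p

namespace PGraph

variable {p : ℕ}

/-- A `p`-labeled graph as a structure over the vocabulary `{E, P_1, …, P_p}`. -/
def toStr (G : PGraph p) : MStr (Fin p) :=
  ⟨G.V, G.adj, fun j v => G.label v = j⟩

/-- The induced labeled subgraph on a set of vertices (with the inherited labels). -/
def induce (G : PGraph p) (s : Set G.V) : PGraph p where
  V := ↥s
  adj a b := G.adj a.1 b.1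
  symm := fun _ _ h => G.symm _ _ h
  irrefl := fun _ h => G.irrefl _ h
  label := fun a => G.label a.1

/-- `G` is an induced labeled subgraph of `H` (up to isomorphism):
there is an injection of `G` into `H` preserving adjacency, non-adjacency and labels. -/
def Emb (G H : PGraph p) : Prop :=
  ∃ f : G.V → H.V, Function.Injective f ∧
    (∀ a b, G.adj a b ↔ H.adj (f a) (f b)) ∧ ∀ a, H.label (f a) = G.label a

end PGraph

/-- A tree model with `r` labels and height `d` for a `p`-labeled graph `G`:
a rooted tree all of whose root-to-leaf paths have length exactly `d`, whose
leaves are exactly the vertices of `G`, each leaf carrying a pair `(i, j)` with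
`i ∈ Fin r` (recorded by `iLab`) and `j` the label of the vertex in `G`,
together with a symmetric signature `S` determining adjacency from the leaf
labels and the distance in the tree. -/
structure TModel (r p d : ℕ) (G : PGraph p) where
  W : Type
  g : SimpleGraph W
  tree : g.IsTree
  root : W
  depthLe : ∀ w, g.dist root w ≤ d
  branch : ∀ w, g.dist root w < d → ∃ w', g.Adj w w' ∧ g.dist root w' = g.dist root w + 1
  leafEquiv : G.V ≃ {w : W // g.dist root w = d}
  iLab : G.V → Fin r
  S : Set (Fin r × Fin r × ℕ)
  S_range : ∀ x ∈ S, 1 ≤ x.2.2 ∧ x.2.2 ≤ d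
  S_symm : ∀ i j l, (i, j, l) ∈ S ↔ (j, i, l) ∈ S
  edge_iff : ∀ u v : G.V, u ≠ v → ∀ l : ℕ,
    g.dist (leafEquiv u).1 (leafEquiv v).1 = 2 * l →
      (G.adj u v ↔ (iLab u, iLab v, l) ∈ S)

/-- The class of all (finite or infinite) `p`-labeled graphs admitting a tree model
with `r` labels and height `d`. -/
def TM (r p d : ℕ) : Set (PGraph p) := {G | Nonempty (TModel r p d G)}

/-- Equality of (possibly infinite) cardinalities up to a threshold `T`. -/
def CapEq (T : ℕ) (a b : ℕ∞) : Prop := a = b ∨ ((T : ℕ∞) ≤ a ∧ (T : ℕ∞) ≤ b)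

namespace CapEq

variable {T : ℕ} {a b c a' b' : ℕ∞}

theorem refl (T : ℕ) (a : ℕ∞) : CapEq T a a := Or.inl rfl

theorem add (h : CapEq T a b) (h' : CapEq T a' b') : CapEq T (a + a') (b + b') := by
  rcases h with rfl | ⟨h1, h2⟩
  · rcases h' with rfl | ⟨h1, h2⟩
    · exact refl _ _
    · exact Or.inr ⟨h1.trans le_add_self, h2.trans le_add_self⟩
  · exact Or.inr ⟨h1.trans le_self_add, h2.trans le_self_add⟩

theorem sum {ι : Type*} (s : Finset ι) (f g : ι → ℕ∞) (h : ∀ i ∈ s, CapEq T (f i) (g i)) :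
    CapEq T (∑ i ∈ s, f i) (∑ i ∈ s, g i) := by
  classical
  induction s using Finset.induction_on with
  | empty => simpa using refl T 0
  | insert i s hi ih =>
    rw [Finset.sum_insert hi, Finset.sum_insert hi]
    exact (h i (Finset.mem_insert_self i s)).add
      (ih fun j hj => h j (Finset.mem_insert_of_mem hj))

end CapEq

/-- A cardinality truncated at `T`. -/
noncomputable def capCard (T : ℕ) (a : ℕ∞) : Fin (T + 1) :=
  ⟨(min a T).toNat, Nat.lt_succ_of_le (ENat.toNat_le_of_le_natCast (min_le_right _ _))⟩

theorem capCard_eq_iff {T : ℕ} {a b : ℕ∞} : capCard T a = capCard T b ↔ CapEq T a b := by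
  have ht : ∀ x : ℕ∞, min x (T : ℕ∞) ≠ ⊤ := fun x =>
    ((min_le_right _ _).trans_lt (ENat.natCast_lt_top T)).ne
  have key : capCard T a = capCard T b ↔ min a (T : ℕ∞) = min b T := by
    simp only [capCard, Fin.mk.injEq]
    exact ⟨fun h => by rw [← ENat.natCast_toNat (ht a), h, ENat.natCast_toNat (ht b)],
      fun h => by rw [h]⟩
  rw [key]
  constructor
  · intro h
    rcases le_total a T with ha | ha <;> rcases le_total b T with hb | hb <;>
      simp only [min_eq_left, min_eq_right, ha, hb] at h
    · exact Or.inl h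
    · subst h; exact Or.inr ⟨le_rfl, hb⟩
    · subst h; exact Or.inr ⟨ha, le_rfl⟩
    · exact Or.inr ⟨ha, hb⟩
  · rintro (rfl | ⟨ha, hb⟩)
    · rfl
    · rw [min_eq_right ha, min_eq_right hb]

/-- A map to a finite set has a small subset of its domain on which all its fibres have the same
cardinality up to a given threshold. -/
theorem exists_small_subset {A Y : Type*} [Finite Y] (f : A → Y) (T : ℕ) :
    ∃ B : Set A, B.encard ≤ (Nat.card Y * T : ℕ) ∧
      ∀ y, {a | f a = y} ⊆ B ∨
        ((T : ℕ∞) ≤ {a | f a = y}.encard ∧ {a | a ∈ B ∧ f a = y}.encard = T) := by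
  classical
  have := Fintype.ofFinite Y
  have h : ∀ y, ∃ B ⊆ {a | f a = y}, B.encard = min {a | f a = y}.encard (T : ℕ∞) :=
    fun y => Set.exists_subset_encard_eq (min_le_left _ _)
  choose B hB hc using h
  refine ⟨⋃ y ∈ (Finset.univ : Finset Y), B y, ?_, fun y => ?_⟩
  · refine (Finset.set_encard_biUnion_le _ _).trans ?_
    refine (Finset.sum_le_sum (g := fun _ => (T : ℕ∞)) fun y _ => ?_).trans ?_
    · rw [hc]; exact min_le_right _ _
    · simp
  · have hfib : {a | a ∈ (⋃ y ∈ (Finset.univ : Finset Y), B y) ∧ f a = y} = B y := by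
      ext a
      simp only [Finset.mem_univ, Set.iUnion_true, Set.mem_iUnion, Set.mem_ofPred_eq]
      constructor
      · rintro ⟨⟨z, hz⟩, rfl⟩
        have : f a = z := hB z hz
        rwa [this]
      · intro ha
        exact ⟨⟨y, ha⟩, hB y ha⟩
    rcases le_total {a | f a = y}.encard (T : ℕ∞) with hle | hle
    · left
      have hfin : {a | f a = y}.Finite := Set.finite_of_encard_le_coe hle
      have : B y = {a | f a = y} := by
        refine hfin.eq_of_subset_of_encard_le' (hB y) ?_
        rw [hc, min_eq_left hle]
      intro a ha
      rw [← this] at ha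
      simp only [Finset.mem_univ, Set.iUnion_true, Set.mem_iUnion]
      exact ⟨y, ha⟩
    · right
      refine ⟨hle, ?_⟩
      rw [hfib, hc, min_eq_right hle]

/-- A map to a finite set `Y` can be copied to another domain of the same cardinality up to a large
threshold, keeping the cardinalities of all fibres up to a smaller threshold. -/
theorem exists_copy {A A' Y : Type*} [Finite Y] {T : ℕ} (hT : 1 ≤ T)
    (h : CapEq ((Nat.card Y + 1) * T) (Set.univ : Set A).encard (Set.univ : Set A').encard)
    (f : A → Y) :
    ∃ f' : A' → Y, (∀ a', ∃ a, f a = f' a') ∧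
      ∀ y, CapEq T {a | f a = y}.encard {a' | f' a' = y}.encard := by
  classical
  by_cases hbig : (((Nat.card Y + 1) * T : ℕ) : ℕ∞) ≤ (Set.univ : Set A).encard ∧
      (((Nat.card Y + 1) * T : ℕ) : ℕ∞) ≤ (Set.univ : Set A').encard
  · obtain ⟨B, hB, hBf⟩ := exists_small_subset f T
    have hlt : Nat.card Y * T < (Nat.card Y + 1) * T := by nlinarith
    obtain ⟨y₀, hy₀, hy₀'⟩ : ∃ y, (T : ℕ∞) ≤ {a | f a = y}.encard ∧
        {a | a ∈ B ∧ f a = y}.encard = T := by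
      by_contra hcon
      have : (Set.univ : Set A) ⊆ B := fun a _ => by
        rcases hBf (f a) with hs | hs
        · exact hs rfl
        · exact absurd ⟨_, hs⟩ hcon
      have h1 := hbig.1.trans ((Set.encard_le_encard this).trans hB)
      exact absurd (by exact_mod_cast h1) (not_le.2 hlt)
    have hBA' : B.encard ≤ (Set.univ : Set A').encard :=
      hB.trans (le_trans (by exact_mod_cast hlt.le) hbig.2)
    have hBfin : B.Finite := Set.finite_of_encard_le_coe hB
    obtain ⟨C, -, hC⟩ := Set.exists_subset_encard_eq hBA'
    have hCfin : C.Finite := by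
      rw [← Set.encard_lt_top_iff, hC]; exact hBfin.encard_lt_top
    have : Finite B := hBfin
    have : Finite C := hCfin
    obtain ⟨e⟩ : Nonempty (B ≃ C) := by
      refine Finite.card_eq.1 ?_
      rw [Nat.card_coe_set_eq, Nat.card_coe_set_eq, Set.ncard_def, Set.ncard_def, hC]
    obtain ⟨a₀, rfl⟩ : {a | f a = y₀}.Nonempty := by
      rw [← Set.one_le_encard_iff_nonempty]
      exact le_trans (by exact_mod_cast hT) hy₀
    let f' : A' → Y := fun a' => if h : a' ∈ C then f (e.symm ⟨a', h⟩) else f a₀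
    have hf' : ∀ b : B, f' (e b) = f b := fun b => by simp [f']
    have hcard : ∀ y, ((fun b : B => (e b : A')) '' {b : B | f b = y}).encard =
        {a | a ∈ B ∧ f a = y}.encard := fun y => by
      have hinj : Function.Injective fun b : B => (e b : A') :=
        Subtype.val_injective.comp e.injective
      rw [hinj.encard_image, ← Subtype.val_injective.encard_image]
      congr 1
      ext a
      simp [and_comm]
    have hsub : ∀ y, (fun b : B => (e b : A')) '' {b : B | f b = y} ⊆ {a' | f' a' = y} := by
      rintro y _ ⟨b, hb, rfl⟩
      exact (hf' b).trans hb
    refine ⟨f', fun a' => ?_, fun y => ?_⟩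
    · by_cases h : a' ∈ C
      · exact ⟨e.symm ⟨a', h⟩, by simp only [f', dif_pos h]⟩
      · exact ⟨a₀, by simp only [f', dif_neg h]⟩
    · by_cases hy : (T : ℕ∞) ≤ {a | f a = y}.encard ∧ {a | a ∈ B ∧ f a = y}.encard = T
      · refine Or.inr ⟨hy.1, ?_⟩
        rw [← hy.2, ← hcard]
        exact Set.encard_le_encard (hsub y)
      · have hyB := (hBf y).resolve_right hy
        left
        have h1 : {a | f a = y} = {a | a ∈ B ∧ f a = y} :=
          Set.ext fun a => ⟨fun ha => ⟨hyB ha, ha⟩, fun ha => ha.2⟩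
        rw [h1, ← hcard]
        congr 1
        refine (hsub y).antisymm fun a' ha' => ?_
        by_cases h : a' ∈ C
        · refine ⟨e.symm ⟨a', h⟩, ?_, by simp⟩
          have : f' a' = f (e.symm ⟨a', h⟩) := dif_pos h
          exact this.symm.trans ha'
        · have : f' a' = f a₀ := dif_neg h
          have : f a₀ = y := this.symm.trans ha'
          subst this
          exact absurd ⟨hy₀, hy₀'⟩ hy
  · have heq := h.resolve_right hbig
    have hfin : (Set.univ : Set A).encard < ⊤ := by
      by_contra hcon
      rw [not_lt, top_le_iff] at hcon
      rw [← heq, hcon] at hbig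
      simp at hbig
    have hfin' := heq ▸ hfin
    rw [Set.encard_lt_top_iff, Set.finite_univ_iff] at hfin hfin'
    obtain ⟨e⟩ : Nonempty (A' ≃ A) := by
      refine Finite.card_eq.1 ?_
      rw [← Set.ncard_univ, ← Set.ncard_univ, Set.ncard_def, Set.ncard_def, heq]
    refine ⟨f ∘ e, fun a' => ⟨e a', rfl⟩, fun y => Or.inl ?_⟩
    rw [← e.injective.encard_image]
    congr 1
    ext a
    constructor
    · intro ha
      exact ⟨e.symm a, by simpa using ha, by simp⟩
    · rintro ⟨a', ha', rfl⟩
      exact ha'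

theorem encard_fibre_eq_sum {A X Y : Type*} [Fintype X] (p : A → X) (f : A → Y) (y : Y) :
    {a | f a = y}.encard = ∑ x, {a : {a // p a = x} | f a = y}.encard := by
  have h : {a | f a = y} = ⋃ x, Subtype.val '' {a : {a // p a = x} | f a = y} := by
    ext a
    simp
  rw [h, Set.encard_iUnion_of_finite, finsum_eq_sum_of_fintype]
  · exact Finset.sum_congr rfl fun x _ => Subtype.val_injective.encard_image _
  · intro x x' hx
    refine Set.disjoint_left.2 ?_
    rintro _ ⟨⟨a, ha⟩, -, rfl⟩ ⟨⟨b, hb⟩, -, hab⟩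
    dsimp only at hab
    subst hab
    exact hx (ha.symm.trans hb)

/-- Fibrewise version of `exists_copy` over a finite base. -/
theorem exists_copy_over {A A' X Y : Type*} [Finite X] [Finite Y] {T : ℕ} (hT : 1 ≤ T)
    (p : A → X) (p' : A' → X)
    (h : ∀ x, CapEq ((Nat.card Y + 1) * T) {a | p a = x}.encard {a' | p' a' = x}.encard)
    (f : A → Y) :
    ∃ f' : A' → Y, (∀ a', ∃ a, p a = p' a' ∧ f a = f' a') ∧
      ∀ y, CapEq T {a | f a = y}.encard {a' | f' a' = y}.encard := by
  have := Fintype.ofFinite X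
  have key : ∀ x, ∃ f' : {a' // p' a' = x} → Y, (∀ a', ∃ a : {a // p a = x}, f a = f' a') ∧
      ∀ y, CapEq T {a : {a // p a = x} | f a = y}.encard {a' | f' a' = y}.encard := fun x => by
    refine exists_copy hT ?_ (fun a : {a // p a = x} => f a)
    have h' := h x
    rw [← Subtype.range_coe_subtype, ← Subtype.range_coe_subtype, ← Set.image_univ,
      ← Set.image_univ, Subtype.val_injective.encard_image,
      Subtype.val_injective.encard_image] at h'
    exact h'
  choose g hg hgc using key
  refine ⟨fun a' => g (p' a') ⟨a', rfl⟩, fun a' => ?_, fun y => ?_⟩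
  · obtain ⟨⟨a, ha⟩, hfa⟩ := hg (p' a') ⟨a', rfl⟩
    exact ⟨a, ha, hfa⟩
  · rw [encard_fibre_eq_sum p, encard_fibre_eq_sum p']
    refine CapEq.sum _ _ _ fun x _ => ?_
    have h2 : {a' : {a' // p' a' = x} | g (p' a') ⟨a', rfl⟩ = y} = {a' | g x a' = y} := by
      ext ⟨a', rfl⟩
      rfl
    rw [h2]
    exact hgc x y

/-- Rooted trees all of whose root-to-leaf paths have length `d`. -/
inductive LTree : ℕ → Type 1
  | leaf : LTree 0
  | node {d : ℕ} (I : Type) (f : I → LTree d) : LTree (d + 1)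

/-- The threshold up to which children of a given type are counted, for `m` remaining moves and
`n` colours, when `N m n` bounds the number of types of children. -/
def typeThreshold (N : ℕ → ℕ → ℕ) : ℕ → ℕ → ℕ
  | 0, _ => 2
  | m + 1, n => (N m (2 * n) + 1) * typeThreshold N m (2 * n)

/-- The number of types of `n`-coloured trees of height `d` for `m` remaining moves. -/
def typeCount : ℕ → ℕ → ℕ → ℕ
  | 0, _, n => n
  | d + 1, m, n => (typeThreshold (typeCount d) m n + 1) ^ typeCount d m n

theorem two_le_typeThreshold (N : ℕ → ℕ → ℕ) (m n : ℕ) : 2 ≤ typeThreshold N m n := by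
  induction m generalizing n with
  | zero => exact le_rfl
  | succ m ih => exact (ih (2 * n)).trans (Nat.le_mul_of_pos_left _ (Nat.succ_pos _))

/-- The types of `C`-coloured trees of height `d` for `m` remaining moves. -/
def TreeType : ℕ → ℕ → Type → Type
  | 0, _, C => C
  | d + 1, m, C => TreeType d m C → Fin (typeThreshold (typeCount d) m (Nat.card C) + 1)

instance TreeType.finite (d m : ℕ) (C : Type) [Finite C] : Finite (TreeType d m C) := by
  induction d with
  | zero => assumption
  | succ d ih => unfold TreeType; infer_instance

theorem TreeType.card_eq (d m : ℕ) (C : Type) [Finite C] :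
    Nat.card (TreeType d m C) = typeCount d m (Nat.card C) := by
  induction d with
  | zero => rfl
  | succ d ih =>
    unfold TreeType
    rw [Nat.card_fun, ih, Nat.card_fin]
    rfl

namespace LTree

/-- The leaves of a tree. -/
def Leaf : {d : ℕ} → LTree d → Type
  | _, leaf => Unit
  | _, node I f => Σ i : I, (f i).Leaf

/-- `t.Meet l u v` says that the lowest common ancestor of the leaves `u` and `v` has height `l`. -/
def Meet : {d : ℕ} → (t : LTree d) → ℕ → t.Leaf → t.Leaf → Prop
  | _, leaf, l, _, _ => l = 0
  | d + 1, node I f, l, u, v =>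
    (∃ (i : I) (x y : (f i).Leaf), u = ⟨i, x⟩ ∧ v = ⟨i, y⟩ ∧ (f i).Meet l x y) ∨
      (u.1 ≠ v.1 ∧ l = d + 1)

/-- The type of a tree with coloured leaves. -/
noncomputable def type (m : ℕ) {C : Type} : {d : ℕ} → (t : LTree d) → (t.Leaf → C) →
    TreeType d m C
  | _, leaf, c => c ()
  | d + 1, node I f, c => fun τ : TreeType d m C =>
    capCard (typeThreshold (typeCount d) m (Nat.card C))
      {i : I | (f i).type m (fun x => c ⟨i, x⟩) = τ}.encard

variable {d m : ℕ} {C : Type}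

theorem type_node_eq_iff {I I' : Type} {f : I → LTree d} {f' : I' → LTree d}
    {c : (node I f).Leaf → C} {c' : (node I' f').Leaf → C} :
    (node I f).type m c = (node I' f').type m c' ↔
      ∀ τ, CapEq (typeThreshold (typeCount d) m (Nat.card C))
        {i | (f i).type m (fun x => c ⟨i, x⟩) = τ}.encard
        {i | (f' i).type m (fun x => c' ⟨i, x⟩) = τ}.encard := by
  simp only [← capCard_eq_iff]
  exact funext_iff

theorem exists_meet (t : LTree d) (u v : t.Leaf) : ∃ l ≤ d, t.Meet l u v := by
  induction t with
  | leaf => exact ⟨0, le_rfl, rfl⟩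
  | @node d I f ih =>
    obtain ⟨i, x⟩ := u
    obtain ⟨j, y⟩ := v
    by_cases h : i = j
    · subst h
      obtain ⟨l, hl, h⟩ := ih i x y
      exact ⟨l, hl.trans (Nat.le_succ d), Or.inl ⟨i, x, y, rfl, rfl, h⟩⟩
    · exact ⟨d + 1, le_rfl, Or.inr ⟨h, rfl⟩⟩

theorem meet_zero_iff (t : LTree d) (u v : t.Leaf) : t.Meet 0 u v ↔ u = v := by
  induction t with
  | leaf => exact ⟨fun _ => rfl, fun _ => rfl⟩
  | node I f ih =>
    constructor
    · rintro (⟨i, x, y, rfl, rfl, h⟩ | ⟨-, h⟩)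
      · rw [(ih i x y).1 h]
      · exact absurd h (Nat.succ_ne_zero _).symm
    · rintro rfl
      exact Or.inl ⟨u.1, u.2, u.2, rfl, rfl, (ih _ _ _).2 rfl⟩

theorem eq_zero_of_meet_self (t : LTree d) {l : ℕ} {u : t.Leaf} (h : t.Meet l u u) : l = 0 := by
  induction t with
  | leaf => exact h
  | node I f ih =>
    rcases h with ⟨i, x, y, rfl, hv, h⟩ | ⟨h, -⟩
    · cases hv
      exact ih i h
    · exact absurd rfl h

theorem exists_child_of_capEq {I I' X : Type} {T : ℕ} (hT : 2 ≤ T) (p : I → X) (p' : I' → X)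
    (h : ∀ x, CapEq T {i | p i = x}.encard {i | p' i = x}.encard) (i : I) :
    ∃ i', p' i' = p i := by
  have h1 : 1 ≤ {j | p j = p i}.encard := Set.one_le_encard_iff_nonempty.2 ⟨i, rfl⟩
  have h2 : 1 ≤ {j | p' j = p i}.encard := by
    rcases h (p i) with h | h
    · exact h ▸ h1
    · exact le_trans (by exact_mod_cast one_le_two.trans hT) h.2
  exact Set.one_le_encard_iff_nonempty.1 h2

theorem exists_children_of_capEq {I I' X : Type} {T : ℕ} (hT : 2 ≤ T) (p : I → X) (p' : I' → X)
    (h : ∀ x, CapEq T {i | p i = x}.encard {i | p' i = x}.encard) {i j : I} (hij : i ≠ j) :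
    ∃ i' j', i' ≠ j' ∧ p' i' = p i ∧ p' j' = p j := by
  by_cases hp : p i = p j
  · have h1 : 1 < {k | p k = p i}.encard := Set.one_lt_encard_iff.2 ⟨i, j, rfl, hp.symm, hij⟩
    have h2 : 1 < {k | p' k = p i}.encard := by
      rcases h (p i) with h | h
      · exact h ▸ h1
      · exact lt_of_lt_of_le (by exact_mod_cast hT) h.2
    obtain ⟨i', j', hi', hj', hne⟩ := Set.one_lt_encard_iff.1 h2
    exact ⟨i', j', hne, hi', Eq.trans hj' hp⟩
  · obtain ⟨i', hi'⟩ := exists_child_of_capEq hT p p' h i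
    obtain ⟨j', hj'⟩ := exists_child_of_capEq hT p p' h j
    refine ⟨i', j', ?_, hi', hj'⟩
    rintro rfl
    exact hp (hi'.symm.trans hj')

theorem exists_leaf_of_type_eq (t t' : LTree d) (c : t.Leaf → C) (c' : t'.Leaf → C)
    (h : t.type m c = t'.type m c') (u : t.Leaf) : ∃ u', c' u' = c u := by
  induction t with
  | leaf =>
    cases t' with
    | leaf => exact ⟨(), Eq.symm h⟩
  | node I f ih =>
    cases t' with
    | node I' f' =>
      obtain ⟨i, x⟩ := u
      obtain ⟨i', hi'⟩ := exists_child_of_capEq (two_le_typeThreshold _ _ _) _ _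
        (type_node_eq_iff.1 h) i
      obtain ⟨x', hx'⟩ := ih i (f' i') _ _ hi'.symm x
      exact ⟨⟨i', x'⟩, hx'⟩

/-- The type determines which pairs of colours meet at which heights. -/
theorem exists_meet_of_type_eq (t t' : LTree d) (c : t.Leaf → C) (c' : t'.Leaf → C)
    (h : t.type m c = t'.type m c') {l : ℕ} {u v : t.Leaf} (huv : t.Meet l u v) :
    ∃ u' v', c' u' = c u ∧ c' v' = c v ∧ t'.Meet l u' v' := by
  induction t with
  | leaf =>
    cases t' with
    | leaf => exact ⟨(), (), Eq.symm h, Eq.symm h, huv⟩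
  | node I f ih =>
    cases t' with
    | node I' f' =>
      rcases huv with ⟨i, x, y, rfl, rfl, hxy⟩ | ⟨hne, rfl⟩
      · obtain ⟨i', hi'⟩ := exists_child_of_capEq (two_le_typeThreshold _ _ _) _ _
          (type_node_eq_iff.1 h) i
        obtain ⟨x', y', hx', hy', hm⟩ := ih i (f' i') _ _ hi'.symm hxy
        exact ⟨⟨i', x'⟩, ⟨i', y'⟩, hx', hy', Or.inl ⟨i', x', y', rfl, rfl, hm⟩⟩
      · obtain ⟨i, x⟩ := u
        obtain ⟨j, y⟩ := v
        obtain ⟨i', j', hne', hi', hj'⟩ := exists_children_of_capEq (two_le_typeThreshold _ _ _) _ _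
          (type_node_eq_iff.1 h) hne
        obtain ⟨x', hx'⟩ := exists_leaf_of_type_eq _ _ _ _ hi'.symm x
        obtain ⟨y', hy'⟩ := exists_leaf_of_type_eq _ _ _ _ hj'.symm y
        exact ⟨⟨i', x'⟩, ⟨j', y'⟩, hx', hy', Or.inr ⟨hne', rfl⟩⟩

theorem eq_of_type_eq (t t' : LTree d) (c : t.Leaf → C) (c' : t'.Leaf → C)
    (h : t.type m c = t'.type m c') {γ : C} (hγ : ∀ u v, c u = γ → c v = γ → u = v)
    {u' v' : t'.Leaf} (hu' : c' u' = γ) (hv' : c' v' = γ) : u' = v' := by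
  obtain ⟨l, -, hl⟩ := t'.exists_meet u' v'
  obtain ⟨u, v, hu, hv, huv⟩ := exists_meet_of_type_eq t' t c' c h.symm hl
  obtain rfl := hγ u v (hu.trans hu') (hv.trans hv')
  rw [← t'.meet_zero_iff, ← t.eq_zero_of_meet_self huv]
  exact hl

/-- Back-and-forth: any refinement of the colouring of a tree by one set can be matched in a tree
of the same type, at the cost of one move. -/
theorem exists_refine [Finite C] (t t' : LTree d) (c : t.Leaf → C) (c' : t'.Leaf → C)
    (h : t.type (m + 1) c = t'.type (m + 1) c') (b : t.Leaf → Bool) :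
    ∃ b' : t'.Leaf → Bool,
      t.type m (fun u => (c u, b u)) = t'.type m (fun u => (c' u, b' u)) := by
  induction t with
  | leaf =>
    cases t' with
    | leaf =>
      refine ⟨fun _ => b (), ?_⟩
      exact Prod.ext h rfl
  | @node d I f ih =>
    cases t' with
    | node I' f' =>
      have hcap := type_node_eq_iff.1 h
      have hthr : typeThreshold (typeCount d) (m + 1) (Nat.card C) =
          (Nat.card (TreeType d m (C × Bool)) + 1) *
            typeThreshold (typeCount d) m (Nat.card (C × Bool)) := by
        have hC : Nat.card (C × Bool) = 2 * Nat.card C := by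
          rw [Nat.card_prod, Nat.card_eq_fintype_card (α := Bool), Fintype.card_bool, mul_comm]
        rw [TreeType.card_eq, hC]
        rfl
      rw [hthr] at hcap
      obtain ⟨g, hg, hgc⟩ := exists_copy_over (one_le_two.trans (two_le_typeThreshold _ _ _)) _ _
        hcap (fun i => (f i).type m (fun x => (c ⟨i, x⟩, b ⟨i, x⟩)))
      have key : ∀ i', ∃ b' : (f' i').Leaf → Bool,
          (f' i').type m (fun x => (c' ⟨i', x⟩, b' x)) = g i' := fun i' => by
        obtain ⟨i, hi, hgi⟩ := hg i'
        obtain ⟨b', hb'⟩ := ih i (f' i') _ _ hi fun x => b ⟨i, x⟩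
        exact ⟨b', hb'.symm.trans hgi⟩
      choose b' hb' using key
      refine ⟨fun u => b' u.1 u.2, type_node_eq_iff.2 fun τ => ?_⟩
      simp only [hb']
      exact hgc τ

/-- A bound on the number of leaves of a tree representing a given type. -/
def sizeBound (m n : ℕ) : ℕ → ℕ
  | 0 => 1
  | d + 1 => typeCount d m n * typeThreshold (typeCount d) m n * sizeBound m n d

/-- Every coloured tree contains a small tree of the same type. -/
theorem exists_small [Finite C] (m : ℕ) (t : LTree d) (c : t.Leaf → C) :
    ∃ (t' : LTree d) (φ : t'.Leaf → t.Leaf),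
      (∀ l u v, t'.Meet l u v → t.Meet l (φ u) (φ v)) ∧
      t'.type m (fun u => c (φ u)) = t.type m c ∧
      Finite t'.Leaf ∧ Nat.card t'.Leaf ≤ sizeBound m (Nat.card C) d := by
  induction t with
  | leaf =>
    refine ⟨leaf, id, fun _ _ _ h => h, rfl, inferInstanceAs (Finite Unit), ?_⟩
    exact (Nat.card_unique (α := Unit)).le
  | @node d I f ih =>
    choose t φ hφ ht hfin hcard using fun i => ih i fun x => c ⟨i, x⟩
    set T := typeThreshold (typeCount d) m (Nat.card C) with hT
    obtain ⟨J, hJ, hJf⟩ :=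
      exists_small_subset (fun i => (f i).type m (fun x => c ⟨i, x⟩)) T
    have hJfin : J.Finite := Set.finite_of_encard_le_coe hJ
    have : Finite J := hJfin
    have := Fintype.ofFinite J
    have hJc : Fintype.card J ≤ typeCount d m (Nat.card C) * T := by
      rw [← TreeType.card_eq, ← Nat.card_eq_fintype_card, Nat.card_coe_set_eq]
      have h := hJ
      rw [← hJfin.cast_ncard_eq] at h
      exact_mod_cast h
    refine ⟨node J fun j => t j, fun u => ⟨u.1, φ u.1 u.2⟩, ?_, ?_, ?_, ?_⟩
    · rintro l _ _ (⟨i, x, y, rfl, rfl, h⟩ | ⟨hne, rfl⟩)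
      · exact Or.inl ⟨i, _, _, rfl, rfl, hφ _ _ _ _ h⟩
      · exact Or.inr ⟨fun h => hne (Subtype.ext h), rfl⟩
    · refine type_node_eq_iff.2 fun τ => ?_
      have himg : {j : J | (t j).type m (fun x => c ⟨j, φ j x⟩) = τ}.encard =
          {i | i ∈ J ∧ (f i).type m (fun x => c ⟨i, x⟩) = τ}.encard := by
        rw [← Subtype.val_injective.encard_image]
        congr 1
        ext i
        simp [ht, and_comm]
      refine Eq.subst (motive := fun e => CapEq T e _) himg.symm ?_
      rcases hJf τ with h | ⟨h1, h2⟩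
      · refine Or.inl (congrArg _ ?_)
        exact Set.ext fun i => ⟨fun hi => hi.2, fun hi => ⟨h hi, hi⟩⟩
      · exact Or.inr ⟨h2.ge, h1⟩
    · exact inferInstanceAs (Finite (Σ j : J, (t j).Leaf))
    · change Nat.card (Σ j : J, (t j).Leaf) ≤ _
      rw [Nat.card_sigma]
      refine (Finset.sum_le_card_nsmul Finset.univ (fun j : J => Nat.card (t j).Leaf) _
        fun j _ => hcard j).trans ?_
      rw [smul_eq_mul, Finset.card_univ]
      exact Nat.mul_le_mul_right _ hJc

end LTree

/-- `M` is described by a tree with coloured leaves: the relations between elements are determined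
by their colours and the height of their meet. -/
structure Described {ι : Type u} (M : MStr ι) {d : ℕ} {C : Type} (t : LTree d) (e : M.V ≃ t.Leaf)
    (c : t.Leaf → C) (R : C → C → ℕ → Prop) (Q : ι → C → Prop) : Prop where
  irrefl : ∀ u, ¬ M.E u u
  edge : ∀ u v l, u ≠ v → t.Meet l (e u) (e v) → (M.E u v ↔ R (c (e u)) (c (e v)) l)
  pred : ∀ a u, M.P a u ↔ Q a (c (e u))

theorem Described.refine {ι : Type u} {M : MStr ι} {d : ℕ} {C : Type} {t : LTree d}
    {e : M.V ≃ t.Leaf} {c : t.Leaf → C} {R : C → C → ℕ → Prop} {Q : ι → C → Prop}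
    (h : Described M t e c R Q) (b : t.Leaf → Bool) :
    Described M t e (fun u => (c u, b u)) (fun x y => R x.1 y.1) (fun a x => Q a x.1) :=
  ⟨h.irrefl, h.edge, h.pred⟩

/-- Two described structures with assignments match when the trees have the same type, the
first-order variables in `F` are assigned elements with unique, equal colours, and the set variables
in `S` are assigned sets defined by the same colours. -/
structure Matched {ι : Type u} (m : ℕ) {M N : MStr ι} {d : ℕ} {C : Type} {t t' : LTree d}
    (e : M.V ≃ t.Leaf) (e' : N.V ≃ t'.Leaf) (c : t.Leaf → C) (c' : t'.Leaf → C)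
    (F S : Finset ℕ) (v : ℕ → M.V) (v' : ℕ → N.V) (s : ℕ → Set M.V) (s' : ℕ → Set N.V) :
    Prop where
  type_eq : t.type m c = t'.type m c'
  color_eq : ∀ i ∈ F, c (e (v i)) = c' (e' (v' i))
  unique_left : ∀ i ∈ F, ∀ u, c (e u) = c (e (v i)) → u = v i
  unique_right : ∀ i ∈ F, ∀ u, c' (e' u) = c' (e' (v' i)) → u = v' i
  set_eq : ∀ X ∈ S, ∃ A : Set C, s X = {u | c (e u) ∈ A} ∧ s' X = {u | c' (e' u) ∈ A}

namespace Matched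

variable {ι : Type u} {m : ℕ} {M N : MStr ι} {d : ℕ} {C : Type} {t t' : LTree d}
  {e : M.V ≃ t.Leaf} {e' : N.V ≃ t'.Leaf} {c : t.Leaf → C} {c' : t'.Leaf → C}
  {F S : Finset ℕ} {v : ℕ → M.V} {v' : ℕ → N.V} {s : ℕ → Set M.V} {s' : ℕ → Set N.V}

theorem symm (h : Matched m e e' c c' F S v v' s s') : Matched m e' e c' c F S v' v s' s where
  type_eq := h.type_eq.symm
  color_eq i hi := (h.color_eq i hi).symm
  unique_left := h.unique_right
  unique_right := h.unique_left
  set_eq X hX := (h.set_eq X hX).imp fun _ hA => hA.symm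

theorem mono {F' S' : Finset ℕ} (h : Matched m e e' c c' F S v v' s s') (hF : F' ⊆ F)
    (hS : S' ⊆ S) : Matched m e e' c c' F' S' v v' s s' where
  type_eq := h.type_eq
  color_eq i hi := h.color_eq i (hF hi)
  unique_left i hi := h.unique_left i (hF hi)
  unique_right i hi := h.unique_right i (hF hi)
  set_eq X hX := h.set_eq X (hS hX)

theorem refine {b : t.Leaf → Bool} {b' : t'.Leaf → Bool} {m' : ℕ}
    (h : Matched m' e e' c c' F S v v' s s')
    (hb : t.type m (fun u => (c u, b u)) = t'.type m (fun u => (c' u, b' u))) :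
    Matched m e e' (fun u => (c u, b u)) (fun u => (c' u, b' u)) F S v v' s s' where
  type_eq := hb
  color_eq i hi := by
    obtain ⟨u', hu'⟩ := LTree.exists_leaf_of_type_eq _ _ _ _ hb (e (v i))
    simp only [Prod.mk.injEq] at hu'
    have : e'.symm u' = v' i := h.unique_right i hi _ (by
      rw [e'.apply_symm_apply, hu'.1, h.color_eq i hi])
    rw [← this, e'.apply_symm_apply]
    exact (Prod.ext hu'.1 hu'.2).symm
  unique_left i hi u hu := h.unique_left i hi u (congrArg Prod.fst hu)
  unique_right i hi u hu := h.unique_right i hi u (congrArg Prod.fst hu)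
  set_eq X hX := by
    obtain ⟨A, hA, hA'⟩ := h.set_eq X hX
    exact ⟨Prod.fst ⁻¹' A, hA, hA'⟩

theorem exists_element [Finite C] (h : Matched (m + 1) e e' c c' F S v v' s s') (n : ℕ)
    (x : M.V) : ∃ (x' : N.V) (b : t.Leaf → Bool) (b' : t'.Leaf → Bool),
      Matched m e e' (fun u => (c u, b u)) (fun u => (c' u, b' u)) (insert n F) S
        (Function.update v n x) (Function.update v' n x') s s' := by
  classical
  let b : t.Leaf → Bool := fun u => decide (u = e x)
  obtain ⟨b', hb'⟩ := LTree.exists_refine t t' c c' h.type_eq b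
  have hM := h.refine hb'
  obtain ⟨u', hu'⟩ := LTree.exists_leaf_of_type_eq _ _ _ _ hb' (e x)
  have huniq : ∀ u w : t.Leaf, (c u, b u) = (c (e x), b (e x)) →
      (c w, b w) = (c (e x), b (e x)) → u = w := by
    intro u w hu hw
    have h1 : b u = b (e x) := congrArg Prod.snd hu
    have h2 : b w = b (e x) := congrArg Prod.snd hw
    simp only [b, decide_true, decide_eq_true_eq] at h1 h2
    rw [h1, h2]
  refine ⟨e'.symm u', b, b', hb', ?_, ?_, ?_, hM.set_eq⟩
  · intro i hi
    by_cases hin : i = n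
    · subst hin
      simpa using hu'.symm
    · rw [Function.update_of_ne hin, Function.update_of_ne hin]
      exact hM.color_eq i (Finset.mem_of_mem_insert_of_ne hi hin)
  · intro i hi u hu
    by_cases hin : i = n
    · subst hin
      rw [Function.update_self] at hu ⊢
      exact e.injective (huniq _ _ hu rfl)
    · rw [Function.update_of_ne hin] at hu ⊢
      exact hM.unique_left i (Finset.mem_of_mem_insert_of_ne hi hin) u hu
  · intro i hi u hu
    by_cases hin : i = n
    · subst hin
      rw [Function.update_self, e'.apply_symm_apply] at hu
      rw [Function.update_self, ← e'.symm_apply_apply u]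
      exact congrArg _ (LTree.eq_of_type_eq _ _ _ _ hb' huniq (hu.trans hu') hu')
    · rw [Function.update_of_ne hin] at hu ⊢
      exact hM.unique_right i (Finset.mem_of_mem_insert_of_ne hi hin) u hu

theorem exists_set [Finite C] (h : Matched (m + 1) e e' c c' F S v v' s s') (n : ℕ)
    (A : Set M.V) : ∃ (A' : Set N.V) (b : t.Leaf → Bool) (b' : t'.Leaf → Bool),
      Matched m e e' (fun u => (c u, b u)) (fun u => (c' u, b' u)) F (insert n S)
        v v' (Function.update s n A) (Function.update s' n A') := by
  classical
  obtain ⟨b', hb'⟩ := LTree.exists_refine t t' c c' h.type_eq fun u => decide (e.symm u ∈ A)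
  have hM := h.refine hb'
  refine ⟨{u | b' (e' u) = true}, _, b', hb', hM.color_eq, hM.unique_left, hM.unique_right, ?_⟩
  intro X hX
  by_cases hXn : X = n
  · subst hXn
    refine ⟨{x | x.2 = true}, ?_, ?_⟩ <;> simp
  · rw [Function.update_of_ne hXn, Function.update_of_ne hXn]
    exact hM.set_eq X (Finset.mem_of_mem_insert_of_ne hX hXn)

theorem eq_of_eq (h : Matched m e e' c c' F S v v' s s') {i j : ℕ} (hi : i ∈ F) (hj : j ∈ F)
    (hij : v i = v j) : v' i = v' j := by
  refine h.unique_right j hj _ ?_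
  rw [← h.color_eq i hi, ← h.color_eq j hj, hij]

end Matched

theorem realize_of_matched {ι : Type u} {d : ℕ} (φ : MSOForm ι) {M N : MStr ι} {t t' : LTree d}
    {e : M.V ≃ t.Leaf} {e' : N.V ≃ t'.Leaf} {m : ℕ} {C : Type} [Finite C]
    {c : t.Leaf → C} {c' : t'.Leaf → C} {R : C → C → ℕ → Prop} {Q : ι → C → Prop}
    {v : ℕ → M.V} {v' : ℕ → N.V} {s : ℕ → Set M.V} {s' : ℕ → Set N.V}
    (hm : φ.qr ≤ m) (hM : Described M t e c R Q) (hN : Described N t' e' c' R Q)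
    (h : Matched m e e' c c' φ.freeFO φ.freeSO v v' s s') (hr : M.Realize φ v s) :
    N.Realize φ v' s' := by
  induction φ generalizing M N t t' e e' m C c c' R Q v v' s s' with
  | fal => exact hr
  | eq i j => exact h.eq_of_eq (by simp [MSOForm.freeFO]) (by simp [MSOForm.freeFO]) hr
  | edge i j =>
    have hi : i ∈ (MSOForm.edge i j : MSOForm ι).freeFO := by simp [MSOForm.freeFO]
    have hj : j ∈ (MSOForm.edge i j : MSOForm ι).freeFO := by simp [MSOForm.freeFO]
    change M.E (v i) (v j) at hr
    change N.E (v' i) (v' j)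
    have hne : v i ≠ v j := fun heq => hM.irrefl _ (heq ▸ hr)
    have hne' : v' i ≠ v' j := fun heq => hne (h.symm.eq_of_eq hi hj heq)
    obtain ⟨l, -, hl⟩ := t.exists_meet (e (v i)) (e (v j))
    obtain ⟨x, y, hx, hy, hxy⟩ := LTree.exists_meet_of_type_eq _ _ _ _ h.type_eq hl
    have hx' : e'.symm x = v' i := h.unique_right i hi _ (by
      rw [e'.apply_symm_apply, hx, h.color_eq i hi])
    have hy' : e'.symm y = v' j := h.unique_right j hj _ (by
      rw [e'.apply_symm_apply, hy, h.color_eq j hj])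
    rw [e'.symm_apply_eq] at hx' hy'
    rw [hx', hy'] at hxy
    rw [hN.edge _ _ l hne' hxy, ← h.color_eq i hi, ← h.color_eq j hj, ← hM.edge _ _ l hne hl]
    exact hr
  | pred a i =>
    have hi : i ∈ (MSOForm.pred a i : MSOForm ι).freeFO := by simp [MSOForm.freeFO]
    change M.P a (v i) at hr
    change N.P a (v' i)
    rwa [hN.pred, ← h.color_eq i hi, ← hM.pred]
  | mem i X =>
    have hi : i ∈ (MSOForm.mem i X : MSOForm ι).freeFO := by simp [MSOForm.freeFO]
    obtain ⟨A, hA, hA'⟩ := h.set_eq X (by simp [MSOForm.freeSO])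
    change v i ∈ s X at hr
    change v' i ∈ s' X
    rw [hA] at hr
    rw [hA']
    change c' (e' (v' i)) ∈ A
    rw [← h.color_eq i hi]
    exact hr
  | imp φ ψ ihφ ihψ =>
    intro hφ
    have h1 := h.mono (F' := φ.freeFO) (S' := φ.freeSO) Finset.subset_union_left
      Finset.subset_union_left
    have h2 := h.mono (F' := ψ.freeFO) (S' := ψ.freeSO) Finset.subset_union_right
      Finset.subset_union_right
    exact ihψ ((le_max_right _ _).trans hm) hM hN h2
      (hr (ihφ ((le_max_left _ _).trans hm) hN hM h1.symm hφ))
  | exFO n φ ih =>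
    obtain ⟨x, hx⟩ := hr
    obtain _ | m := m
    · exact absurd hm (Nat.not_succ_le_zero _)
    obtain ⟨x', b, b', h'⟩ := h.exists_element n x
    exact ⟨x', ih (Nat.le_of_succ_le_succ hm) (hM.refine b) (hN.refine b')
      (h'.mono (Finset.subset_insert_iff.2 subset_rfl) subset_rfl) hx⟩
  | exSO n φ ih =>
    obtain ⟨A, hA⟩ := hr
    obtain _ | m := m
    · exact absurd hm (Nat.not_succ_le_zero _)
    obtain ⟨A', b, b', h'⟩ := h.exists_set n A
    exact ⟨A', ih (Nat.le_of_succ_le_succ hm) (hM.refine b) (hN.refine b')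
      (h'.mono subset_rfl (Finset.subset_insert_iff.2 subset_rfl)) hA⟩

theorem msoEquiv_of_type_eq {ι : Type u} {d : ℕ} {M N : MStr ι} [Nonempty M.V] [Nonempty N.V]
    {t t' : LTree d} {e : M.V ≃ t.Leaf} {e' : N.V ≃ t'.Leaf} {m : ℕ} {C : Type} [Finite C]
    {c : t.Leaf → C} {c' : t'.Leaf → C} {R : C → C → ℕ → Prop} {Q : ι → C → Prop}
    (hM : Described M t e c R Q) (hN : Described N t' e' c' R Q)
    (h : t.type m c = t'.type m c') : MStr.MSOEquiv m M N := by
  intro φ hφ hm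
  have key : ∀ v v' s s', Matched m e e' c c' φ.freeFO φ.freeSO v v' s s' := by
    intro v v' s s'
    rw [hφ.1, hφ.2]
    exact ⟨h, by simp, by simp, by simp, by simp⟩
  constructor
  · intro hs v' s'
    have v : ℕ → M.V := fun _ => Classical.arbitrary _
    exact realize_of_matched φ hm hM hN (key v v' (fun _ => ∅) s') (hs _ _)
  · intro hs v s
    have v' : ℕ → N.V := fun _ => Classical.arbitrary _
    exact realize_of_matched φ hm hN hM (key v v' s fun _ => ∅).symm (hs _ _)

theorem mul_tower_le (d : ℕ) {k y : ℕ} (hk : 1 ≤ k) (hy : 1 ≤ y) :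
    k * tower d y ≤ tower d (k * y) ∧ 1 ≤ tower d y := by
  induction d with
  | zero => exact ⟨le_rfl, hy⟩
  | succ d ih =>
    refine ⟨?_, Nat.one_le_two_pow⟩
    change k * 2 ^ tower d y ≤ 2 ^ tower d (k * y)
    calc k * 2 ^ tower d y ≤ 2 ^ (k - 1) * 2 ^ tower d y := by
          refine Nat.mul_le_mul_right _ ?_
          have := Nat.lt_two_pow_self (n := k - 1)
          omega
      _ = 2 ^ (k - 1 + tower d y) := (pow_add _ _ _).symm
      _ ≤ 2 ^ tower d (k * y) := by
          refine Nat.pow_le_pow_right two_pos (le_trans ?_ ih.1)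
          obtain ⟨k, rfl⟩ := Nat.exists_eq_add_of_le' hk
          have := ih.2
          rw [Nat.add_sub_cancel]
          nlinarith

theorem tower_mono (d : ℕ) : Monotone (tower d) := by
  induction d with
  | zero => exact monotone_id
  | succ d ih => exact fun a b h => Nat.pow_le_pow_right two_pos (ih h)

/-- Binary logarithm of a bound on the number of types of trees. -/
def typeExponent (x : ℕ) : ℕ → ℕ
  | 0 => x
  | d + 1 => 2 ^ (5 * typeExponent x d)

theorem le_typeExponent (x d : ℕ) : x ≤ typeExponent x d := by
  induction d with
  | zero => exact le_rfl
  | succ d ih => exact ih.trans ((Nat.le_mul_of_pos_left _ (by norm_num)).trans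
      Nat.lt_two_pow_self.le)

theorem typeExponent_le_succ (x d : ℕ) : typeExponent x d ≤ typeExponent x (d + 1) :=
  (Nat.le_mul_of_pos_left _ (by norm_num)).trans Nat.lt_two_pow_self.le

theorem typeExponent_le_tower {x : ℕ} (hx : 1 ≤ x) (d : ℕ) :
    typeExponent x d ≤ tower d (5 ^ d * x) := by
  induction d with
  | zero => simp [typeExponent, tower]
  | succ d ih =>
    refine Nat.pow_le_pow_right two_pos ?_
    have h := (mul_tower_le d (k := 5) (y := 5 ^ d * x) (by norm_num)
      (Nat.mul_pos (by positivity) hx)).1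
    calc 5 * typeExponent x d ≤ 5 * tower d (5 ^ d * x) := Nat.mul_le_mul_left _ ih
      _ ≤ tower d (5 * (5 ^ d * x)) := h
      _ = tower d (5 ^ (d + 1) * x) := by ring_nf

theorem typeThreshold_le {N : ℕ → ℕ → ℕ} {x B : ℕ}
    (hN : ∀ m n, m ≤ x → n * 2 ^ m ≤ 2 ^ x → N m n ≤ 2 ^ B) (m n : ℕ) (hm : m ≤ x)
    (hn : n * 2 ^ m ≤ 2 ^ x) : typeThreshold N m n ≤ 2 ^ (1 + (B + 1) * m) := by
  induction m generalizing n with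
  | zero => simp [typeThreshold]
  | succ m ih =>
    have hn' : 2 * n * 2 ^ m ≤ 2 ^ x := by
      rw [pow_succ] at hn
      linarith
    have h1 := hN m (2 * n) (by omega) hn'
    have h2 := ih (2 * n) (by omega) hn'
    calc typeThreshold N (m + 1) n
        = (N m (2 * n) + 1) * typeThreshold N m (2 * n) := rfl
      _ ≤ 2 ^ (B + 1) * 2 ^ (1 + (B + 1) * m) := by
          refine Nat.mul_le_mul ?_ h2
          have := Nat.one_le_two_pow (n := B)
          rw [pow_succ]
          omega
      _ = 2 ^ (1 + (B + 1) * (m + 1)) := by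
          rw [← pow_add]
          ring_nf

theorem typeCount_le {x : ℕ} (hx : 1 ≤ x) (d m n : ℕ) (hm : m ≤ x) (hn : n * 2 ^ m ≤ 2 ^ x) :
    typeCount d m n ≤ 2 ^ typeExponent x d := by
  induction d generalizing m n with
  | zero => exact (Nat.le_mul_of_pos_right n (by positivity)).trans hn
  | succ d ih =>
    have hthr := typeThreshold_le ih m n hm hn
    have hcount := ih m n hm hn
    have hxB := le_typeExponent x d
    change (typeThreshold (typeCount d) m n + 1) ^ typeCount d m n ≤
      2 ^ 2 ^ (5 * typeExponent x d)
    set B := typeExponent x d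
    have hB : B + 1 ≤ 2 ^ B := Nat.lt_two_pow_self
    have hexp : 2 + (B + 1) * m ≤ 2 ^ (4 * B) := by
      have h1 : (B + 1) * m ≤ 2 ^ B * 2 ^ B := Nat.mul_le_mul hB (by omega)
      have h2 : 2 ≤ 2 ^ B := by omega
      have h3 : 2 ^ (4 * B) = 2 ^ B * 2 ^ B * (2 ^ B * 2 ^ B) := by
        rw [← pow_add, ← pow_add]
        ring_nf
      rw [h3]
      have h4 : 4 ≤ 2 ^ B * 2 ^ B := Nat.mul_le_mul h2 h2
      nlinarith
    calc (typeThreshold (typeCount d) m n + 1) ^ typeCount d m n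
        ≤ (2 ^ (2 + (B + 1) * m)) ^ typeCount d m n := by
          refine Nat.pow_le_pow_left ?_ _
          have := Nat.one_le_two_pow (n := 1 + (B + 1) * m)
          rw [show 2 + (B + 1) * m = 1 + (B + 1) * m + 1 by ring, pow_succ]
          omega
      _ ≤ (2 ^ (2 + (B + 1) * m)) ^ 2 ^ B :=
          Nat.pow_le_pow_right (by positivity) hcount
      _ = 2 ^ ((2 + (B + 1) * m) * 2 ^ B) := (pow_mul _ _ _).symm
      _ ≤ 2 ^ 2 ^ (5 * B) := by
          refine Nat.pow_le_pow_right two_pos ?_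
          calc (2 + (B + 1) * m) * 2 ^ B ≤ 2 ^ (4 * B) * 2 ^ B := Nat.mul_le_mul_right _ hexp
            _ = 2 ^ (5 * B) := by rw [← pow_add]; ring_nf

namespace LTree

theorem sizeBound_succ_le {x : ℕ} (hx : 1 ≤ x) (m n d : ℕ) (hm : m ≤ x)
    (hn : n * 2 ^ m ≤ 2 ^ x) :
    sizeBound m n (d + 1) ≤ 2 ^ (5 * x * (d + 1) * typeExponent x d) := by
  have hstep : ∀ d, typeCount d m n * typeThreshold (typeCount d) m n ≤
      2 ^ (5 * x * typeExponent x d) := fun d => by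
    have h1 := typeCount_le hx d m n hm hn
    have h2 := typeThreshold_le (typeCount_le hx d) m n hm hn
    have hxB := le_typeExponent x d
    set B := typeExponent x d
    refine (Nat.mul_le_mul h1 h2).trans ?_
    rw [← pow_add]
    refine Nat.pow_le_pow_right two_pos ?_
    have h3 : (B + 1) * m ≤ (B + 1) * x := Nat.mul_le_mul_left _ hm
    nlinarith
  induction d with
  | zero => simpa [sizeBound] using hstep 0
  | succ d ih =>
    refine (Nat.mul_le_mul (hstep (d + 1)) ih).trans ?_
    rw [← pow_add]
    refine Nat.pow_le_pow_right two_pos ?_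
    have h := Nat.mul_le_mul_left (5 * x * (d + 1)) (typeExponent_le_succ x d)
    linarith

theorem exists_sizeBound_le_tower (n d : ℕ) :
    ∃ K, ∀ m, 1 ≤ m → sizeBound m n d ≤ tower d (K * m * m) := by
  obtain _ | d := d
  · exact ⟨1, fun m hm => Nat.mul_pos (Nat.mul_pos one_pos hm) hm⟩
  refine ⟨5 ^ (d + 1) * (d + 1) * ((n + 1) * (n + 1)), fun m hm => ?_⟩
  have hx : 1 ≤ m + n := by omega
  have hn : n * 2 ^ m ≤ 2 ^ (m + n) := by
    rw [pow_add, mul_comm]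
    exact Nat.mul_le_mul_left _ Nat.lt_two_pow_self.le
  refine (sizeBound_succ_le hx m n d (Nat.le_add_right _ _) hn).trans
    (Nat.pow_le_pow_right two_pos ?_)
  refine (Nat.mul_le_mul_left _ (typeExponent_le_tower hx d)).trans
    ((mul_tower_le d (Nat.mul_pos (by omega) (by omega))
      (Nat.mul_pos (by positivity) hx)).1.trans (tower_mono d ?_))
  have hxm : m + n ≤ (n + 1) * m := by nlinarith
  calc 5 * (m + n) * (d + 1) * (5 ^ d * (m + n))
      = 5 ^ (d + 1) * (d + 1) * ((m + n) * (m + n)) := by ring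
    _ ≤ 5 ^ (d + 1) * (d + 1) * (((n + 1) * m) * ((n + 1) * m)) :=
        Nat.mul_le_mul_left _ (Nat.mul_le_mul hxm hxm)
    _ = 5 ^ (d + 1) * (d + 1) * ((n + 1) * (n + 1)) * m * m := by ring

end LTree

/-- The graph `g` is a tree with root `root` whose parent map is `par` and whose depth function is
`dep`; by convention the root is its own parent. -/
structure RootedBy {W : Type*} (g : SimpleGraph W) (root : W) (par : W → W) (dep : W → ℕ) :
    Prop where
  par_root : par root = root
  dep_root : dep root = 0
  dep_eq : ∀ w, w ≠ root → dep w = dep (par w) + 1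
  adj_iff : ∀ a b, g.Adj a b ↔ (a ≠ root ∧ par a = b) ∨ (b ≠ root ∧ par b = a)

namespace RootedBy

variable {W : Type*} {g : SimpleGraph W} {root : W} {par : W → W} {dep : W → ℕ}

theorem eq_root (h : RootedBy g root par dep) {w : W} (hw : dep w = 0) : w = root := by
  by_contra hne
  exact absurd (h.dep_eq w hne) (by omega)

theorem dep_iterate (h : RootedBy g root par dep) (k : ℕ) (w : W) :
    dep (par^[k] w) = dep w - k := by
  induction k generalizing w with
  | zero => rfl
  | succ k ih =>
    rw [Function.iterate_succ_apply, ih]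
    by_cases hw : w = root
    · subst hw
      rw [h.par_root, h.dep_root]
      omega
    · have := h.dep_eq w hw
      omega

theorem iterate_eq_root (h : RootedBy g root par dep) {k : ℕ} {w : W} (hw : dep w ≤ k) :
    par^[k] w = root :=
  h.eq_root (by rw [h.dep_iterate]; omega)

theorem exists_walk_of_iterate_eq (h : RootedBy g root par dep) {k : ℕ} {w x : W}
    (hx : par^[k] w = x) : ∃ p : g.Walk w x, p.length ≤ k := by
  induction k generalizing w with
  | zero =>
    subst hx
    exact ⟨.nil, le_rfl⟩
  | succ k ih =>
    obtain ⟨p, hp⟩ := ih hx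
    by_cases hw : w = root
    · subst hw
      obtain ⟨q, hq⟩ := ih (w := w) (by rwa [Function.iterate_succ_apply, h.par_root] at hx)
      exact ⟨q, hq.trans (Nat.le_succ k)⟩
    · exact ⟨.cons ((h.adj_iff _ _).2 (Or.inl ⟨hw, rfl⟩)) p, Nat.succ_le_succ hp⟩

theorem connected (h : RootedBy g root par dep) : g.Connected := by
  have hr : ∀ w, g.Reachable w root := fun w =>
    (h.exists_walk_of_iterate_eq (h.iterate_eq_root le_rfl)).nonempty
  have : Nonempty W := ⟨root⟩
  exact ⟨fun a b => (hr a).trans (hr b).symm⟩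

theorem exists_iterate_eq_of_walk (h : RootedBy g root par dep) {u v : W} (p : g.Walk u v) :
    ∃ a b, a + b ≤ p.length ∧ par^[a] u = par^[b] v := by
  induction p with
  | nil => exact ⟨0, 0, le_rfl, rfl⟩
  | @cons u u' v hadj p ih =>
    obtain ⟨a, b, hab, heq⟩ := ih
    rw [SimpleGraph.Walk.length_cons]
    rcases (h.adj_iff _ _).1 hadj with ⟨-, rfl⟩ | ⟨-, rfl⟩
    · exact ⟨a + 1, b, by omega, heq⟩
    · obtain _ | a := a
      · refine ⟨0, b + 1, by omega, ?_⟩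
        rw [Function.iterate_succ_apply', ← heq]
        rfl
      · exact ⟨a, b, by omega, heq⟩

theorem dist_root (h : RootedBy g root par dep) (w : W) : g.dist root w = dep w := by
  apply le_antisymm
  · obtain ⟨p, hp⟩ := h.exists_walk_of_iterate_eq (h.iterate_eq_root (le_refl (dep w)))
    rw [SimpleGraph.dist_comm]
    exact (SimpleGraph.dist_le p).trans hp
  · obtain ⟨p, hp⟩ := h.connected.exists_walk_length_eq_dist root w
    obtain ⟨a, b, hab, heq⟩ := h.exists_iterate_eq_of_walk p
    have := congrArg dep heq
    rw [h.dep_iterate, h.dep_iterate, h.dep_root] at this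
    omega

theorem dist_eq (h : RootedBy g root par dep) {u v : W} (huv : dep u = dep v) {l : ℕ}
    (hl : par^[l] u = par^[l] v) (hmin : ∀ k < l, par^[k] u ≠ par^[k] v) :
    g.dist u v = 2 * l := by
  have hroot : par^[dep u] u = par^[dep u] v := by
    rw [h.iterate_eq_root le_rfl, h.iterate_eq_root huv.ge]
  have hld : l ≤ dep u := not_lt.1 fun hlt => hmin _ hlt hroot
  apply le_antisymm
  · obtain ⟨p, hp⟩ := h.exists_walk_of_iterate_eq hl
    obtain ⟨q, hq⟩ := h.exists_walk_of_iterate_eq (x := par^[l] v) rfl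
    refine (SimpleGraph.dist_le (p.append q.reverse)).trans ?_
    rw [SimpleGraph.Walk.length_append, SimpleGraph.Walk.length_reverse]
    omega
  · obtain ⟨p, hp⟩ := h.connected.exists_walk_length_eq_dist u v
    obtain ⟨a, b, hab, heq⟩ := h.exists_iterate_eq_of_walk p
    have hdep := congrArg dep heq
    rw [h.dep_iterate, h.dep_iterate] at hdep
    by_contra hlt
    have hal : a = b ∧ a < l := by omega
    exact hmin a hal.2 (hal.1 ▸ heq)

theorem exists_least_iterate_eq (h : RootedBy g root par dep) {u v : W} (huv : dep u = dep v) :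
    ∃ l, par^[l] u = par^[l] v ∧ ∀ k < l, par^[k] u ≠ par^[k] v := by
  classical
  have hex : ∃ l, par^[l] u = par^[l] v :=
    ⟨dep u, by rw [h.iterate_eq_root le_rfl, h.iterate_eq_root huv.ge]⟩
  exact ⟨Nat.find hex, Nat.find_spec hex, fun k hk => Nat.find_min hex hk⟩

/-- A set of nodes closed under parents inherits the rooted tree structure. -/
theorem induce (h : RootedBy g root par dep) {s : Set W} (hroot : root ∈ s)
    (hpar : ∀ w ∈ s, par w ∈ s) :
    RootedBy (g.induce s) ⟨root, hroot⟩ (fun w => ⟨par w, hpar w w.2⟩) (fun w => dep w) where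
  par_root := Subtype.ext h.par_root
  dep_root := h.dep_root
  dep_eq w hw := h.dep_eq w fun heq => hw (Subtype.ext heq)
  adj_iff a b := by
    simp only [SimpleGraph.comap_adj, Function.Embedding.subtype_apply, h.adj_iff, ne_eq,
      Subtype.ext_iff]

end RootedBy

theorem SimpleGraph.IsTree.exists_rootedBy {W : Type*} {g : SimpleGraph W} (hg : g.IsTree)
    (root : W) : ∃ par : W → W, RootedBy g root par (g.dist root) := by
  classical
  have hex : ∀ w, ∃ w', (w = root → w' = root) ∧
      (w ≠ root → g.Adj w w' ∧ ∀ x, g.Adj w x → g.dist root x < g.dist root w → x = w') := by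
    intro w
    obtain ⟨p, hp, hlen⟩ := hg.connected.exists_path_of_dist root w
    refine ⟨p.penultimate, ?_, fun hw => ⟨?_, ?_⟩⟩
    · rintro rfl
      rw [SimpleGraph.Walk.isPath_iff_nil] at hp
      cases hp
      rfl
    · exact (p.adj_penultimate (SimpleGraph.Walk.not_nil_of_ne (Ne.symm hw))).symm
    · intro x hx hlt
      refine hg.isAcyclic.eq_penultimate_of_adj_end hp hx ?_
      obtain ⟨q, hq, hqlen⟩ := hg.connected.exists_path_of_dist root x
      refine hg.isAcyclic.mem_support_of_ne_mem_support_of_adj_of_isPath hp hq hx ?_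
      intro hmem
      have h1 := (SimpleGraph.dist_le (q.takeUntil w hmem)).trans
        (q.length_takeUntil_le_length hmem)
      omega
  choose par hroot hpar using hex
  have hdist : ∀ w, w ≠ root → g.dist root w = g.dist root (par w) + 1 := by
    intro w hw
    obtain ⟨p, hp, hlen⟩ := hg.connected.exists_path_of_dist root w
    have hadj := (p.adj_penultimate (SimpleGraph.Walk.not_nil_of_ne (Ne.symm hw))).symm
    have hlt : g.dist root p.penultimate < g.dist root w := by
      have h1 := SimpleGraph.dist_le p.dropLast
      have h2 : 0 < g.dist root w := hg.connected.pos_dist_of_ne (Ne.symm hw)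
      have h3 : p.dropLast.length < p.length := by
        simp; omega
      omega
    rw [← (hpar w hw).2 _ hadj hlt]
    have := hg.dist_eq_dist_add_one_of_adj root hadj
    omega
  refine ⟨par, hroot root rfl, SimpleGraph.dist_self, hdist, fun a b => ⟨fun hab => ?_, ?_⟩⟩
  · rcases hg.dist_eq_dist_add_one_of_adj root hab with h | h
    · have ha : a ≠ root := by
        rintro rfl
        simp at h
      exact Or.inl ⟨ha, ((hpar a ha).2 b hab (by omega)).symm⟩
    · have hb : b ≠ root := by
        rintro rfl
        simp at h
      exact Or.inr ⟨hb, ((hpar b hb).2 a hab.symm (by omega)).symm⟩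
  · rintro (⟨ha, rfl⟩ | ⟨hb, rfl⟩)
    · exact (hpar a ha).1
    · exact (hpar b hb).1.symm

/-- A chain of increasingly coarse partitions of a set, from the discrete one to the trivial one,
is realised by a tree. -/
theorem LTree.exists_of_ancestors (d : ℕ) {V W : Type} [Nonempty V] (a : ℕ → V → W)
    (hinj : Function.Injective (a 0))
    (hstep : ∀ l < d, ∀ u v, a l u = a l v → a (l + 1) u = a (l + 1) v)
    (htop : ∀ u v, a d u = a d v) :
    ∃ (t : LTree d) (e : V ≃ t.Leaf), ∀ u v l, t.Meet l (e u) (e v) →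
      a l u = a l v ∧ ∀ k < l, a k u ≠ a k v := by
  induction d generalizing V with
  | zero =>
    have : Subsingleton V := ⟨fun u v => hinj (htop u v)⟩
    have : Unique V := Classical.choice (nonempty_unique V)
    refine ⟨leaf, Equiv.ofUnique V Unit, ?_⟩
    rintro u v l rfl
    exact ⟨htop u v, fun k hk => absurd hk (Nat.not_lt_zero k)⟩
  | succ d ih =>
    let q : V → Set.range (a d) := fun v => ⟨a d v, v, rfl⟩
    have key : ∀ i, ∃ (t : LTree d) (e : {v // q v = i} ≃ t.Leaf), ∀ u v l,
        t.Meet l (e u) (e v) → a l u = a l v ∧ ∀ k < l, a k u ≠ a k v := by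
      rintro ⟨_, v, rfl⟩
      have : Nonempty {v' // q v' = ⟨a d v, v, rfl⟩} := ⟨⟨v, rfl⟩⟩
      refine ih (fun l (v : {v' // q v' = ⟨a d v, v, rfl⟩}) => a l v) (hinj.comp Subtype.val_injective)
        (fun l hl u v => hstep l (by omega) u v) fun u v => ?_
      exact congrArg Subtype.val (u.2.trans v.2.symm)
    choose t e he using key
    refine ⟨node _ t, (Equiv.sigmaFiberEquiv q).symm.trans (Equiv.sigmaCongrRight e), ?_⟩
    rintro u v l (⟨i, x, y, hx, hy, hm⟩ | ⟨hne, rfl⟩)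
    · have hu : q u = i := congrArg Sigma.fst hx
      have hv : q v = i := congrArg Sigma.fst hy
      subst hu
      have hx' : e (q u) ⟨u, rfl⟩ = x := eq_of_heq (Sigma.mk.inj hx).2
      have hy' : e (q u) ⟨v, hv⟩ = y := by
        have h1 : (⟨q u, e (q u) ⟨v, hv⟩⟩ : (i : _) × (t i).Leaf) = ⟨q v, e (q v) ⟨v, rfl⟩⟩ := by
          generalize q u = i at hv
          subst hv
          rfl
        exact eq_of_heq (Sigma.mk.inj (h1.trans hy)).2
      subst hx' hy'
      exact he _ _ _ _ hm
    · refine ⟨htop u v, fun k hk heq => hne (Subtype.ext ?_)⟩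
      obtain ⟨j, rfl⟩ : ∃ j, d = k + j := Nat.exists_eq_add_of_le (by omega)
      have : ∀ i ≤ j, a (k + i) u = a (k + i) v := by
        intro i
        induction i with
        | zero => exact fun _ => heq
        | succ i ihi => exact fun hi => hstep (k + i) (by omega) u v (ihi (by omega))
      exact this j le_rfl

namespace TModel

variable {r p d : ℕ} {G : PGraph p}

/-- The node of the tree model representing a vertex. -/
def leaf (T : TModel r p d G) (u : G.V) : T.W := (T.leafEquiv u).1

theorem dist_leaf (T : TModel r p d G) (u : G.V) : T.g.dist T.root (T.leaf u) = d :=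
  (T.leafEquiv u).2

theorem leaf_injective (T : TModel r p d G) : Function.Injective T.leaf :=
  Subtype.val_injective.comp T.leafEquiv.injective

theorem nonempty (T : TModel r p d G) : Nonempty G.V := by
  have key : ∀ k ≤ d, ∃ w, T.g.dist T.root w = k := by
    intro k
    induction k with
    | zero => exact fun _ => ⟨T.root, SimpleGraph.dist_self⟩
    | succ k ih =>
      intro hk
      obtain ⟨w, hw⟩ := ih (by omega)
      obtain ⟨w', -, hw'⟩ := T.branch w (by omega)
      exact ⟨w', by omega⟩
  obtain ⟨w, hw⟩ := key d le_rfl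
  exact ⟨T.leafEquiv.symm ⟨w, hw⟩⟩

/-- The tree model of an induced subgraph, consisting of the ancestors of its vertices. -/
theorem nonempty_induce (T : TModel r p d G) {s : Set G.V} (hs : s.Nonempty) :
    Nonempty (TModel r p d (G.induce s)) := by
  obtain ⟨par, hpar⟩ := T.tree.exists_rootedBy T.root
  let N : Set T.W := {w | ∃ x ∈ s, ∃ k, par^[k] (T.leaf x) = w}
  have hroot : T.root ∈ N := by
    obtain ⟨x, hx⟩ := hs
    exact ⟨x, hx, d, hpar.iterate_eq_root (T.dist_leaf x).le⟩
  have hN : ∀ w ∈ N, par w ∈ N := by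
    rintro _ ⟨x, hx, k, rfl⟩
    exact ⟨x, hx, k + 1, Function.iterate_succ_apply' par k _⟩
  have hind := hpar.induce hroot hN
  have hdist := hind.dist_root
  have hleaf : ∀ x ∈ s, T.leaf x ∈ N := fun x hx => ⟨x, hx, 0, rfl⟩
  have hiter : ∀ k (w : N), (((fun w : N => (⟨par w, hN w w.2⟩ : N))^[k] w : N) : T.W)
      = par^[k] w := by
    intro k w
    induction k with
    | zero => rfl
    | succ k ih =>
      rw [Function.iterate_succ_apply', Function.iterate_succ_apply', ← ih]
  have hdist_leaf : ∀ u v : N, T.g.dist T.root u = T.g.dist T.root v →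
      (T.g.induce N).dist u v = T.g.dist (u : T.W) v := by
    intro u v huv
    obtain ⟨l, hl, hmin⟩ := hpar.exists_least_iterate_eq huv
    rw [hpar.dist_eq huv hl hmin]
    refine hind.dist_eq huv (Subtype.ext ?_) fun k hk heq => hmin k hk ?_
    · rw [hiter, hiter, hl]
    · rw [← hiter, ← hiter, heq]
  let f : s → {w : N // (T.g.induce N).dist ⟨T.root, hroot⟩ w = d} := fun x =>
    ⟨⟨T.leaf x, hleaf x x.2⟩, (hdist _).trans (T.dist_leaf x)⟩
  have hf : Function.Bijective f := by
    refine ⟨fun x y hxy => Subtype.ext (T.leaf_injective ?_), ?_⟩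
    · exact congrArg (fun w => w.1.1) hxy
    · rintro ⟨⟨w, x, hx, k, rfl⟩, hw⟩
      refine ⟨⟨x, hx⟩, Subtype.ext (Subtype.ext ?_)⟩
      rw [hdist] at hw
      change T.leaf x = par^[k] (T.leaf x)
      simp only [hpar.dep_iterate, T.dist_leaf] at hw
      obtain _ | k := k
      · rfl
      · rw [hpar.iterate_eq_root (by rw [T.dist_leaf]; omega)]
        exact hpar.eq_root (by rw [T.dist_leaf]; omega)
  exact ⟨{
    W := N
    g := T.g.induce N
    tree := ⟨hind.connected, T.tree.isAcyclic.induce N⟩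
    root := ⟨T.root, hroot⟩
    depthLe := fun w => (hdist w).trans_le (T.depthLe w)
    branch := by
      rintro ⟨w, hwN⟩ hw
      obtain ⟨x, hx, k, hkd, rfl⟩ : ∃ x ∈ s, ∃ k ≤ d, par^[k] (T.leaf x) = w := by
        obtain ⟨x, hx, k, rfl⟩ := hwN
        rcases le_total k d with hk | hk
        · exact ⟨x, hx, k, hk, rfl⟩
        · refine ⟨x, hx, d, le_rfl, ?_⟩
          rw [hpar.iterate_eq_root (T.dist_leaf x).le,
            hpar.iterate_eq_root ((T.dist_leaf x).le.trans hk)]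
      simp only [hdist, hpar.dep_iterate, T.dist_leaf] at hw
      obtain _ | k := k
      · omega
      · refine ⟨⟨par^[k] (T.leaf x), x, hx, k, rfl⟩, ?_, ?_⟩
        · refine (hind.adj_iff _ _).2 (Or.inr ⟨fun heq => ?_, Subtype.ext ?_⟩)
          · have := congrArg (fun w : N => T.g.dist T.root w) heq
            simp only [hpar.dep_iterate, T.dist_leaf, SimpleGraph.dist_self] at this
            omega
          · exact (Function.iterate_succ_apply' par k _).symm
        · simp only [hdist, hpar.dep_iterate, T.dist_leaf]
          omega
    leafEquiv := Equiv.ofBijective f hf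
    iLab := fun u => T.iLab u.1
    S := T.S
    S_range := T.S_range
    S_symm := T.S_symm
    edge_iff := by
      intro u v huv l hl
      refine T.edge_iff u.1 v.1 (fun heq => huv (Subtype.ext heq)) l ?_
      rw [← hl]
      exact (hdist_leaf (f u).1 (f v).1 ((T.dist_leaf _).trans (T.dist_leaf _).symm)).symm }⟩

/-- A graph with a tree model is described by a tree with leaves coloured by the leaf labels. -/
theorem exists_described (T : TModel r p d G) :
    ∃ (t : LTree d) (e : G.V ≃ t.Leaf) (c : t.Leaf → Fin r × Fin p),
      Described G.toStr t e c (fun x y l => (x.1, y.1, l) ∈ T.S) (fun j x => x.2 = j) := by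
  obtain ⟨par, hpar⟩ := T.tree.exists_rootedBy T.root
  have := T.nonempty
  obtain ⟨t, e, he⟩ := LTree.exists_of_ancestors d (fun l u => par^[l] (T.leaf u))
    T.leaf_injective
    (fun l _ u v h => by
      simp only [Function.iterate_succ_apply'] at h ⊢
      rw [h])
    (fun u v => by
      simp only [hpar.iterate_eq_root (T.dist_leaf _).le])
  refine ⟨t, e, fun x => (T.iLab (e.symm x), G.label (e.symm x)), G.irrefl, ?_, ?_⟩
  · intro (u : G.V) (v : G.V) l huv hm
    obtain ⟨hl, hmin⟩ := he u v l hm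
    change G.adj u v ↔ (T.iLab (e.symm (e u)), T.iLab (e.symm (e v)), l) ∈ T.S
    rw [e.symm_apply_apply, e.symm_apply_apply]
    exact T.edge_iff u v huv l
      (hpar.dist_eq ((T.dist_leaf u).trans (T.dist_leaf v).symm) hl hmin)
  · intro j u
    exact (congrArg (G.label · = j) (e.symm_apply_apply u).symm).to_iff

end TModel

/-- Small `MSO[m]`-equivalent induced labeled subgraphs in `TM(r,p,d)`,
with an elementary bound on the size. -/
theorem stmt0 (d p r : ℕ) :
    ∃ h : ℕ → ℕ, StrictMono h ∧
      ∀ m : ℕ, 1 ≤ m → ∀ G ∈ TM r p d,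
        ∃ s : Set G.V, G.induce s ∈ TM r p d ∧
          Cardinal.mk ↥s ≤
            ((tower d (h d * m * (m + Nat.clog 2 r + Nat.clog 2 p)) : ℕ) : Cardinal) ∧
          MStr.MSOEquiv m (G.induce s).toStr G.toStr := by
  obtain ⟨K, hK⟩ := LTree.exists_sizeBound_le_tower (Nat.card (Fin r × Fin p)) d
  refine ⟨fun n => n + K, fun a b hab => Nat.add_lt_add_right hab K, ?_⟩
  rintro m hm G ⟨T⟩
  obtain ⟨t, e, c, hG⟩ := T.exists_described
  obtain ⟨t', φ, hmeet, htype, hfin, hcard⟩ := LTree.exists_small m t c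
  have hφ : Function.Injective φ := fun x y hxy =>
    (LTree.meet_zero_iff t' x y).1 <| by
      obtain ⟨l, -, hl⟩ := t'.exists_meet x y
      have := hmeet l x y hl
      rw [hxy] at this
      obtain rfl := LTree.eq_zero_of_meet_self _ this
      exact hl
  have hinj : Function.Injective fun x => e.symm (φ x) := e.symm.injective.comp hφ
  let s : Set G.V := Set.range fun x => e.symm (φ x)
  let e' : t'.Leaf ≃ s := Equiv.ofInjective _ hinj
  have he' : ∀ x, ((e' x : G.V)) = e.symm (φ x) := fun _ => rfl
  have hval : ∀ u : s, φ (e'.symm u) = e u.1 := fun u => by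
    obtain ⟨x, rfl⟩ := e'.surjective u
    rw [e'.symm_apply_apply, he', e.apply_symm_apply]
  have : Nonempty G.V := T.nonempty
  have : Nonempty G.toStr.V := T.nonempty
  have hne : Nonempty t'.Leaf :=
    (LTree.exists_leaf_of_type_eq _ _ _ _ htype.symm (e (Classical.arbitrary _))).nonempty
  have hs : s.Nonempty := Set.range_nonempty _
  have : Nonempty (G.induce s).toStr.V := hs.to_subtype
  have hH : Described (G.induce s).toStr t' e'.symm (fun x => c (φ x))
      (fun x y l => (x.1, y.1, l) ∈ T.S) (fun j x => x.2 = j) := by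
    refine ⟨fun u => G.irrefl u.1, fun (u v : s) l huv hl => ?_, fun j (u : s) => ?_⟩
    · have := hmeet _ _ _ hl
      change G.adj u v ↔ ((c (φ (e'.symm u))).1, (c (φ (e'.symm v))).1, l) ∈ T.S
      change t.Meet l (φ (e'.symm u)) (φ (e'.symm v)) at this
      rw [hval, hval] at this ⊢
      exact hG.edge u.1 v.1 l (fun h => huv (Subtype.ext h)) this
    · change G.label u = j ↔ (c (φ (e'.symm u))).2 = j
      rw [hval]
      exact hG.pred j u.1
  refine ⟨s, T.nonempty_induce hs, ?_, msoEquiv_of_type_eq hH hG htype⟩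
  rw [← Cardinal.mk_congr e', ← Nat.cast_card, Nat.cast_le]
  refine hcard.trans ((hK m hm).trans (tower_mono d ?_))
  have hKd : K ≤ d + K := Nat.le_add_left K d
  gcongr
  omega
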